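/- arXiv:2304.07181 — 2 statements merged into one kernel-verified Lean document; each statement's English description precedes it below -/
import Mathlib

section
/- Let p be a prime, a ≥ 1 a natural number, and set q = p^a. Let R be a Noetherian commutative ring of characteristic p that is an integral domain, and let I be an ideal of R which is stable under the q-power Frobenius in the sense that the ideal of R generated by { x^q : x ∈ I } equals I (equivalently, Ideal.map applied to I along the a-th iterate of the Frobenius ring endomorphism of R equals I). Then I is the zero ideal or the unit ideal. -/
/-- let `p` be a prime, `a ≥ 1`, `q = p ^ a`, and let `R` be a Noetherian
integral domain of characteristic `p`.  If `I` is an ideal of `R` which is stable under the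
`q`-power Frobenius, in the sense that the ideal generated by `{ x ^ q : x ∈ I }` equals `I`,
then `I` is the zero ideal or the unit ideal. -/
theorem statement2 (p a : ℕ) (hp : p.Prime) (ha : 1 ≤ a) (q : ℕ) (hq : q = p ^ a)
    (R : Type*) [CommRing R] [IsNoetherianRing R] [IsDomain R] [CharP R p]
    (I : Ideal R)
    (hI : Ideal.span ((fun x : R => x ^ q) '' (I : Set R)) = I) :
    I = ⊥ ∨ I = ⊤ := by
  have hq2 : 2 ≤ q := by
    rw [hq]
    exact hp.two_le.trans (Nat.le_self_pow (by omega) p)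
  refine (Ideal.isIdempotentElem_iff_eq_bot_or_top I (IsNoetherian.noetherian I)).mp ?_
  refine le_antisymm Ideal.mul_le_left ?_
  rw [← pow_two]
  conv_lhs => rw [← hI]
  rw [Ideal.span_le]
  rintro _ ⟨x, hx, rfl⟩
  exact Ideal.pow_le_pow_right hq2 (Ideal.pow_mem_pow hx q)
end

section
/- Let A be a commutative ring, let f and p be elements of A, and let r ≥ 1 be a natural number. Set B := A[T,X]/(f^r·T − p, f^r·X − p), the quotient of the polynomial ring in two variables by the ideal generated by f^r·T − p and f^r·X − p. Then: (i) in B one has p·(T̄ − X̄) = 0, where T̄ and X̄ denote the classes of T and X; (ii) the A-algebra homomorphism φ : B → A[X]/(f^r·X − p) determined by T ↦ X̄ and X ↦ X̄ is surjective, and its kernel is the ideal of B generated by T̄ − X̄; in particular the kernel of φ is annihilated by p, so φ becomes an isomorphism after inverting p. -/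
/-- let `A` be a commutative ring, `f p : A`, `r ≥ 1`, and set
`B = A[T,X]/(fʳT − p, fʳX − p)` (with `T`, `X` the two variables of `MvPolynomial (Fin 2) A`)
and `C = A[X]/(fʳX − p)`.  Then `p·(T̄ − X̄) = 0` in `B`; and the `A`-algebra homomorphism
`φ : B → C` determined by `T ↦ X̄`, `X ↦ X̄` is surjective with kernel the ideal generated by
`T̄ − X̄`; in particular the kernel of `φ` is annihilated by `p`, so `φ` becomes an
isomorphism after inverting `p`. -/
theorem statement5 {A : Type*} [CommRing A] (f p : A) (r : ℕ) (hr : 1 ≤ r)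
    (I : Ideal (MvPolynomial (Fin 2) A))
    (hI : I = Ideal.span
      { MvPolynomial.C (f ^ r) * MvPolynomial.X 0 - MvPolynomial.C p,
        MvPolynomial.C (f ^ r) * MvPolynomial.X 1 - MvPolynomial.C p })
    (J : Ideal (Polynomial A))
    (hJ : J = Ideal.span {Polynomial.C (f ^ r) * Polynomial.X - Polynomial.C p})
    (φ : (MvPolynomial (Fin 2) A ⧸ I) →ₐ[A] (Polynomial A ⧸ J))
    (hφT : φ (Ideal.Quotient.mk I (MvPolynomial.X 0)) = Ideal.Quotient.mk J Polynomial.X)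
    (hφX : φ (Ideal.Quotient.mk I (MvPolynomial.X 1)) = Ideal.Quotient.mk J Polynomial.X) :
    algebraMap A (MvPolynomial (Fin 2) A ⧸ I) p *
        (Ideal.Quotient.mk I (MvPolynomial.X 0) - Ideal.Quotient.mk I (MvPolynomial.X 1)) = 0 ∧
    Function.Surjective φ ∧
    RingHom.ker φ = Ideal.span
        {Ideal.Quotient.mk I (MvPolynomial.X 0) - Ideal.Quotient.mk I (MvPolynomial.X 1)} ∧
    (∀ x ∈ RingHom.ker φ, algebraMap A (MvPolynomial (Fin 2) A ⧸ I) p * x = 0) ∧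
    Function.Bijective
      (Localization.awayMapₐ φ (algebraMap A (MvPolynomial (Fin 2) A ⧸ I) p)) := by
  have h0 : algebraMap A (MvPolynomial (Fin 2) A ⧸ I) (f ^ r) *
      Ideal.Quotient.mk I (MvPolynomial.X 0) = algebraMap A _ p := by
    have : Ideal.Quotient.mk I
        (MvPolynomial.C (f ^ r) * MvPolynomial.X 0 - MvPolynomial.C p) = 0 := by
      rw [Ideal.Quotient.eq_zero_iff_mem, hI]
      exact Ideal.subset_span (by simp)
    rw [map_sub, map_mul, sub_eq_zero] at this
    exact this
  have h1 : algebraMap A (MvPolynomial (Fin 2) A ⧸ I) (f ^ r) *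
      Ideal.Quotient.mk I (MvPolynomial.X 1) = algebraMap A _ p := by
    have : Ideal.Quotient.mk I
        (MvPolynomial.C (f ^ r) * MvPolynomial.X 1 - MvPolynomial.C p) = 0 := by
      rw [Ideal.Quotient.eq_zero_iff_mem, hI]
      exact Ideal.subset_span (by simp)
    rw [map_sub, map_mul, sub_eq_zero] at this
    exact this
  have hp : algebraMap A (MvPolynomial (Fin 2) A ⧸ I) p *
        (Ideal.Quotient.mk I (MvPolynomial.X 0) - Ideal.Quotient.mk I (MvPolynomial.X 1)) = 0 := by
    linear_combination (Ideal.Quotient.mk I (MvPolynomial.X 1)) * h0 -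
      (Ideal.Quotient.mk I (MvPolynomial.X 0)) * h1
  have hsurj : Function.Surjective φ := by
    intro y
    obtain ⟨q, rfl⟩ := Ideal.Quotient.mk_surjective y
    refine ⟨Polynomial.aeval (Ideal.Quotient.mk I (MvPolynomial.X 1)) q, ?_⟩
    have : (φ.comp (Polynomial.aeval (Ideal.Quotient.mk I (MvPolynomial.X 1)))) =
        Ideal.Quotient.mkₐ A J := by
      apply Polynomial.algHom_ext
      simp [hφX]
    exact DFunLike.congr_fun this q
  have hker : RingHom.ker φ = Ideal.span
        {Ideal.Quotient.mk I (MvPolynomial.X 0) - Ideal.Quotient.mk I (MvPolynomial.X 1)} := by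
    apply le_antisymm
    · intro x hx
      rw [RingHom.mem_ker] at hx
      set K : Ideal (MvPolynomial (Fin 2) A ⧸ I) := Ideal.span
        {Ideal.Quotient.mk I (MvPolynomial.X 0) - Ideal.Quotient.mk I (MvPolynomial.X 1)} with hK
      let x1 : (MvPolynomial (Fin 2) A ⧸ I) ⧸ K :=
        Ideal.Quotient.mkₐ A K (Ideal.Quotient.mk I (MvPolynomial.X 1))
      have hle : ∀ a ∈ J, Polynomial.aeval (R := A) x1 a = 0 := by
        intro a ha
        have : J ≤ RingHom.ker (Polynomial.aeval (R := A) x1) := by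
          rw [hJ, Ideal.span_le, Set.singleton_subset_iff, SetLike.mem_coe, RingHom.mem_ker]
          rw [map_sub, map_mul, Polynomial.aeval_C, Polynomial.aeval_C, Polynomial.aeval_X,
            sub_eq_zero]
          have := congrArg (Ideal.Quotient.mkₐ A K) h1
          rw [map_mul, AlgHom.commutes, AlgHom.commutes] at this
          exact this
        exact this ha
      let ψ : (Polynomial A ⧸ J) →ₐ[A] ((MvPolynomial (Fin 2) A ⧸ I) ⧸ K) :=
        Ideal.Quotient.liftₐ J (Polynomial.aeval x1) hle
      have hψX : ψ (Ideal.Quotient.mk J Polynomial.X) = x1 := by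
        change Polynomial.aeval (R := A) x1 Polynomial.X = x1
        simp
      have hcomp : (ψ.comp φ).comp (Ideal.Quotient.mkₐ A I) =
          (Ideal.Quotient.mkₐ A K).comp (Ideal.Quotient.mkₐ A I) := by
        apply MvPolynomial.algHom_ext
        intro i
        fin_cases i
        · change ψ (φ (Ideal.Quotient.mk I (MvPolynomial.X 0))) =
            Ideal.Quotient.mk K (Ideal.Quotient.mk I (MvPolynomial.X 0))
          rw [hφT, hψX]
          refine ((Ideal.Quotient.mk_eq_mk_iff_sub_mem _ _).2 ?_).symm
          exact Ideal.subset_span rfl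
        · change ψ (φ (Ideal.Quotient.mk I (MvPolynomial.X 1))) =
            Ideal.Quotient.mk K (Ideal.Quotient.mk I (MvPolynomial.X 1))
          rw [hφX, hψX]
          rfl
      obtain ⟨q, rfl⟩ := Ideal.Quotient.mk_surjective x
      have h2 : ψ (φ (Ideal.Quotient.mk I q)) = Ideal.Quotient.mk K (Ideal.Quotient.mk I q) :=
        DFunLike.congr_fun hcomp q
      rw [hx, map_zero] at h2
      exact Ideal.Quotient.eq_zero_iff_mem.1 h2.symm
    · rw [Ideal.span_le, Set.singleton_subset_iff, SetLike.mem_coe, RingHom.mem_ker, map_sub,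
        hφT, hφX, sub_self]
  have hann : ∀ x ∈ RingHom.ker φ, algebraMap A (MvPolynomial (Fin 2) A ⧸ I) p * x = 0 := by
    intro x hx
    rw [hker, Ideal.mem_span_singleton] at hx
    obtain ⟨c, rfl⟩ := hx
    rw [← mul_assoc, hp, zero_mul]
  refine ⟨hp, hsurj, hker, hann, ?_, ?_⟩
  · rw [injective_iff_map_eq_zero]
    intro z hz
    obtain ⟨x, s, rfl⟩ := IsLocalization.exists_mk'_eq
      (Submonoid.powers (algebraMap A (MvPolynomial (Fin 2) A ⧸ I) p)) z
    change IsLocalization.Away.map _ _ φ.toRingHom _ _ = 0 at hz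
    rw [IsLocalization.Away.map, IsLocalization.map_mk', IsLocalization.mk'_eq_zero_iff] at hz
    obtain ⟨⟨_, n, rfl⟩, hn⟩ := hz
    rw [IsLocalization.mk'_eq_zero_iff]
    refine ⟨⟨_, n + 1, rfl⟩, ?_⟩
    have : (algebraMap A (MvPolynomial (Fin 2) A ⧸ I) p) ^ n * x ∈ RingHom.ker φ := by
      rw [RingHom.mem_ker, map_mul, map_pow]
      exact hn
    have := hann _ this
    change (algebraMap A (MvPolynomial (Fin 2) A ⧸ I) p) ^ (n + 1) * x = 0
    rw [pow_succ', mul_assoc, this]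
  · intro z
    obtain ⟨y, ⟨_, n, rfl⟩, rfl⟩ := IsLocalization.exists_mk'_eq
      (Submonoid.powers (φ (algebraMap A (MvPolynomial (Fin 2) A ⧸ I) p))) z
    obtain ⟨x, rfl⟩ := hsurj y
    refine ⟨IsLocalization.mk' _ x (⟨_, n, rfl⟩ :
      Submonoid.powers (algebraMap A (MvPolynomial (Fin 2) A ⧸ I) p)), ?_⟩
    change IsLocalization.Away.map _ _ φ.toRingHom _ _ = _
    rw [IsLocalization.Away.map, IsLocalization.map_mk']
    congr 1
    ext
    simp
end
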